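/- For every real γ with π/4 < γ < π/2, there exist a spherical triangle Δ (given by linearly independent unit vectors in ℝ³) whose corner angles are π − γ/2, π/2 − γ/2, and γ, and a family T₁, …, T₈ of subsets of the unit sphere S² in ℝ³ such that each Tᵢ is the image of Δ under a linear isometry of ℝ³, the union of the Tᵢ is S², and the interiors of the Tᵢ in the subspace topology of S² are pairwise disjoint. -/

import Mathlib

open scoped RealInnerProductSpace

/-- The corner angle of the spherical triangle with vertices `A`, `B`, `C` at the
vertex `A`: the angle between the orthogonal projections of `B` and `C` onto the
tangent plane of the unit sphere at `A`. -/
noncomputable def cornerAngle (A B C : EuclideanSpace ℝ (Fin 3)) : ℝ :=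
  InnerProductGeometry.angle (B - ⟪B, A⟫ • A) (C - ⟪C, A⟫ • A)

/-- The spherical triangle with vertices `A`, `B`, `C`: the intersection of the unit
sphere with the cone `{sA + tB + uC : s, t, u ≥ 0}`. -/
def sphericalTriangle (A B C : EuclideanSpace ℝ (Fin 3)) : Set (EuclideanSpace ℝ (Fin 3)) :=
  Metric.sphere 0 1 ∩
    {x | ∃ s t u : ℝ, 0 ≤ s ∧ 0 ≤ t ∧ 0 ≤ u ∧ x = s • A + t • B + u • C}

abbrev E3 := EuclideanSpace ℝ (Fin 3)

/-- Recognise a corner angle from the three pairwise inner products. -/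
lemma cornerAngle_eq_of (A B C : E3) (θ x y z : ℝ) (hA : ‖A‖ = 1) (hB : ‖B‖ = 1) (hC : ‖C‖ = 1)
    (hx : ⟪B, A⟫ = x) (hy : ⟪C, A⟫ = y) (hz : ⟪B, C⟫ = z) (hx1 : 0 < 1 - x ^ 2)
    (hy1 : 0 < 1 - y ^ 2) (h0 : 0 ≤ θ) (hpi : θ ≤ Real.pi)
    (hsq : (z - x * y) ^ 2 = Real.cos θ ^ 2 * ((1 - x ^ 2) * (1 - y ^ 2)))
    (hs : 0 ≤ (z - x * y) * Real.cos θ) : cornerAngle A B C = θ := by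
  have hAA : ⟪A, A⟫ = 1 := by rw [real_inner_self_eq_norm_sq, hA]; norm_num
  have hBB : ⟪B, B⟫ = 1 := by rw [real_inner_self_eq_norm_sq, hB]; norm_num
  have hCC : ⟪C, C⟫ = 1 := by rw [real_inner_self_eq_norm_sq, hC]; norm_num
  have hx' : ⟪A, B⟫ = x := by rw [real_inner_comm]; exact hx
  have hy' : ⟪A, C⟫ = y := by rw [real_inner_comm]; exact hy
  have e1 : ⟪B - ⟪B, A⟫ • A, C - ⟪C, A⟫ • A⟫ = z - x * y := by
    simp only [inner_sub_left, inner_sub_right, real_inner_smul_left, real_inner_smul_right,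
      hx, hy, hz, hAA, hx', hy']
    ring
  have e2 : ‖B - ⟪B, A⟫ • A‖ ^ 2 = 1 - x ^ 2 := by
    rw [← real_inner_self_eq_norm_sq]
    simp only [inner_sub_left, inner_sub_right, real_inner_smul_left, real_inner_smul_right,
      hx, hAA, hx', hBB]
    ring
  have e3 : ‖C - ⟪C, A⟫ • A‖ ^ 2 = 1 - y ^ 2 := by
    rw [← real_inner_self_eq_norm_sq]
    simp only [inner_sub_left, inner_sub_right, real_inner_smul_left, real_inner_smul_right,
      hy, hAA, hy', hCC]
    ring
  unfold cornerAngle InnerProductGeometry.angle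
  rw [e1]
  generalize hU : ‖B - ⟪B, A⟫ • A‖ = U at *
  generalize hV : ‖C - ⟪C, A⟫ • A‖ = V at *
  have hU0 : 0 < U := by
    have : 0 ≤ U := by rw [← hU]; exact norm_nonneg _
    rcases this.lt_or_eq with h | h
    · exact h
    · rw [← h] at e2; norm_num at e2; linarith
  have hV0 : 0 < V := by
    have : 0 ≤ V := by rw [← hV]; exact norm_nonneg _
    rcases this.lt_or_eq with h | h
    · exact h
    · rw [← h] at e3; norm_num at e3; linarith
  have key : z - x * y = Real.cos θ * (U * V) := by
    rw [← e2, ← e3] at hsq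
    have h2 : (z - x * y) ^ 2 = (Real.cos θ * (U * V)) ^ 2 := by rw [hsq]; ring
    rcases sq_eq_sq_iff_eq_or_eq_neg.mp h2 with h | h
    · exact h
    · rw [h] at hs
      have hUV := mul_pos hU0 hV0
      have : Real.cos θ ^ 2 ≤ 0 := by
        by_contra hc
        push Not at hc
        nlinarith [mul_pos hc hUV]
      have hc : Real.cos θ = 0 := by
        have := le_antisymm this (sq_nonneg _)
        exact pow_eq_zero_iff (two_ne_zero) |>.mp this
      rw [h, hc]; ring
  have hUV : U * V ≠ 0 := (mul_pos hU0 hV0).ne'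
  rw [key, mul_div_assoc, div_self hUV, mul_one, Real.arccos_cos h0 hpi]

/-- The first kind of tile, in scaled coordinates. -/
def MTile (t X Y Z : ℝ) : Prop := 0 ≤ (1 + t) * Y + Z ∧ 0 ≤ X - Y ∧ 0 ≤ X - t * Y - Z

/-- The second (mirror) kind of tile, in scaled coordinates. -/
def RTile (t X Y Z : ℝ) : Prop := 0 ≤ X + Y ∧ 0 ≤ Z - (1 - t) * X ∧ 0 ≤ t * Y + Z - X

lemma dart (t X Y Z : ℝ) (ht : 0 < t) (hp : 0 ≤ (1 + t) * Y + Z) (hl : 0 ≤ X + Y)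
    (h : 0 ≤ X - Y ∨ 0 ≤ Z - (1 - t) * X) : MTile t X Y Z ∨ RTile t X Y Z := by
  rcases le_total 0 (X - t * Y - Z) with hn | hn
  · left
    refine ⟨hp, ?_, hn⟩
    rcases h with h | h
    · exact h
    · have : 0 ≤ t * (X - Y) := by linarith
      exact nonneg_of_mul_nonneg_right this ht
  · right
    refine ⟨hl, ?_, by linarith⟩
    rcases h with h | h
    · have := mul_nonneg ht.le h
      linarith
    · exact h

/-- The eight tiles cover. -/
lemma cover (t X Y Z : ℝ) (ht : 0 < t) :
    (MTile t X Y Z ∨ RTile t X Y Z) ∨ (MTile t X (-Y) (-Z) ∨ RTile t X (-Y) (-Z)) ∨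
    (MTile t (-X) Y (-Z) ∨ RTile t (-X) Y (-Z)) ∨
    (MTile t (-X) (-Y) Z ∨ RTile t (-X) (-Y) Z) := by
  have d1 := dart t X Y Z ht
  have d2 := dart t X (-Y) (-Z) ht
  have d3 := dart t (-X) Y (-Z) ht
  have d4 := dart t (-X) (-Y) Z ht
  rcases le_total 0 (X + Y) with h1 | h1 <;> rcases le_total 0 (X - Y) with h2 | h2
  · rcases le_total 0 ((1 + t) * Y + Z) with h | h
    · exact Or.inl (d1 h h1 (Or.inl h2))
    · exact Or.inr (Or.inl (d2 (by linarith) (by linarith) (Or.inl (by linarith))))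
  · have h2' : 0 ≤ t * (Y - X) := mul_nonneg ht.le (by linarith)
    have h1' : 0 ≤ t * (X + Y) := mul_nonneg ht.le h1
    rcases le_total 0 (Z - (1 - t) * X) with h | h
    · exact Or.inl (d1 (by linarith) h1 (Or.inr h))
    · exact Or.inr (Or.inr (Or.inl (d3 (by linarith) (by linarith) (Or.inr (by linarith)))))
  · have h2' : 0 ≤ t * (X - Y) := mul_nonneg ht.le (by linarith)
    have h1' : t * (X + Y) ≤ 0 := mul_nonpos_of_nonneg_of_nonpos ht.le h1
    rcases le_total 0 (-Z - (1 - t) * X) with h | h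
    · exact Or.inr (Or.inl (d2 (by linarith) (by linarith) (Or.inr (by linarith))))
    · exact Or.inr (Or.inr (Or.inr (d4 (by linarith) (by linarith) (Or.inr (by linarith)))))
  · rcases le_total 0 ((1 + t) * Y - Z) with h | h
    · exact Or.inr (Or.inr (Or.inl (d3 (by linarith) (by linarith) (Or.inl (by linarith)))))
    · exact Or.inr (Or.inr (Or.inr (d4 (by linarith) (by linarith) (Or.inl (by linarith)))))

/-- Open dart. -/
def ODart (t X Y Z : ℝ) : Prop :=
  0 < (1 + t) * Y + Z ∧ 0 < X + Y ∧ (0 < X - Y ∨ 0 < Z - (1 - t) * X)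

lemma odart_disj1 {t X Y Z : ℝ} (h : ODart t X Y Z) : ¬ ODart t X (-Y) (-Z) := by
  rintro ⟨h1, -, -⟩
  have := h.1
  linarith

lemma odart_disj2 {t X Y Z : ℝ} (h : ODart t X Y Z) : ¬ ODart t (-X) Y (-Z) := by
  rintro ⟨h1, h2, h3⟩
  obtain ⟨g1, g2, g3⟩ := h
  rcases h3 with h3 | h3 <;> rcases g3 with g3 | g3 <;> linarith

lemma odart_disj3 {t X Y Z : ℝ} (h : ODart t X Y Z) : ¬ ODart t (-X) (-Y) Z := by
  rintro ⟨h1, h2, -⟩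
  have := h.2.1
  linarith

/-- Signs of the four rotations. -/
def sg : Fin 4 → Fin 3 → ℝ := ![![1, 1, 1], ![1, -1, -1], ![-1, 1, -1], ![-1, -1, 1]]

lemma sg_sq (j : Fin 4) (i : Fin 3) : sg j i * sg j i = 1 := by
  fin_cases j <;> fin_cases i <;> simp [sg]

lemma odart_disj {t X Y Z : ℝ} {i j : Fin 4}
    (hi : ODart t (sg i 0 * X) (sg i 1 * Y) (sg i 2 * Z))
    (hj : ODart t (sg j 0 * X) (sg j 1 * Y) (sg j 2 * Z)) : i = j := by
  have d1 := odart_disj1 hi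
  have d2 := odart_disj2 hi
  have d3 := odart_disj3 hi
  fin_cases i <;> fin_cases j <;> simp [sg] at * <;> contradiction

/-- An involutive norm-preserving linear map is a linear isometry equivalence. -/
noncomputable def involIso (f : E3 →ₗ[ℝ] E3) (h : Function.Involutive f)
    (hn : ∀ x, ‖f x‖ = ‖x‖) : E3 ≃ₗᵢ[ℝ] E3 where
  toLinearEquiv := LinearEquiv.ofInvolutive f h
  norm_map' := hn

lemma mem_involIso_image (f : E3 →ₗ[ℝ] E3) (h : Function.Involutive f)
    (hn : ∀ x, ‖f x‖ = ‖x‖) (S : Set E3) (x : E3) : x ∈ involIso f h hn '' S ↔ f x ∈ S := by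
  constructor
  · rintro ⟨y, hy, rfl⟩
    have : f (involIso f h hn y) = y := h y
    rwa [this]
  · intro hx
    exact ⟨f x, hx, h x⟩

/-- Diagonal sign maps. -/
noncomputable def diagMap (j : Fin 4) : E3 →ₗ[ℝ] E3 where
  toFun x := WithLp.toLp 2 (fun i => sg j i * x i)
  map_add' x y := by ext i; simp [mul_add]
  map_smul' r x := by ext i; simp; ring

lemma diagMap_apply (j : Fin 4) (x : E3) (i : Fin 3) : diagMap j x i = sg j i * x i := rfl

lemma diagMap_invol (j : Fin 4) : Function.Involutive (diagMap j) := by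
  intro x
  ext i
  rw [diagMap_apply, diagMap_apply, ← mul_assoc, sg_sq, one_mul]

lemma diagMap_norm (j : Fin 4) (x : E3) : ‖diagMap j x‖ = ‖x‖ := by
  rw [EuclideanSpace.norm_eq, EuclideanSpace.norm_eq]
  congr 1
  refine Finset.sum_congr rfl fun i _ => ?_
  rw [diagMap_apply, Real.norm_eq_abs, Real.norm_eq_abs, sq_abs, sq_abs, mul_pow, pow_two (sg j i),
    sg_sq, one_mul]

/-- Reflection in the plane orthogonal to `n`. -/
noncomputable def reflMap (κ : ℝ) (n : E3) : E3 →ₗ[ℝ] E3 where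
  toFun x := x - (κ * ⟪n, x⟫) • n
  map_add' x y := by rw [inner_add_right]; module
  map_smul' r x := by rw [real_inner_smul_right, RingHom.id_apply]; module

lemma reflMap_apply (κ : ℝ) (n x : E3) : reflMap κ n x = x - (κ * ⟪n, x⟫) • n := rfl

lemma reflMap_invol (κ : ℝ) (n : E3) (h : κ * ⟪n, n⟫ = 2) : Function.Involutive (reflMap κ n) := by
  intro x
  rw [reflMap_apply, reflMap_apply, inner_sub_right, real_inner_smul_right]
  have : κ * (⟪n, x⟫ - κ * ⟪n, x⟫ * ⟪n, n⟫) = -(κ * ⟪n, x⟫) := by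
    linear_combination (-(κ * ⟪n, x⟫)) * h
  rw [this]
  module

lemma reflMap_norm (κ : ℝ) (n : E3) (h : κ * ⟪n, n⟫ = 2) (x : E3) : ‖reflMap κ n x‖ = ‖x‖ := by
  have : ‖reflMap κ n x‖ ^ 2 = ‖x‖ ^ 2 := by
    rw [← real_inner_self_eq_norm_sq, ← real_inner_self_eq_norm_sq, reflMap_apply]
    simp only [inner_sub_left, inner_sub_right, real_inner_smul_left, real_inner_smul_right,
      real_inner_comm n x]
    linear_combination (κ * ⟪n, x⟫ ^ 2) * h
  exact (sq_eq_sq₀ (norm_nonneg _) (norm_nonneg _)).mp this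

/-- A point in the relative interior of a set where a nonzero linear functional is nonnegative
has a strictly positive value. -/
lemma strict_of_interior (v : E3) (hv : v ≠ 0) (T : Set E3) (hT : ∀ x ∈ T, 0 ≤ ⟪v, x⟫)
    (x : Metric.sphere (0 : E3) 1)
    (hx : x ∈ interior ((↑) ⁻¹' T : Set (Metric.sphere (0 : E3) 1))) : 0 < ⟪v, (x : E3)⟫ := by
  have hx0 := hT x (Set.mem_preimage.mp (interior_subset hx))
  rcases hx0.lt_or_eq with h | h
  · exact h
  exfalso
  have hnx : ‖(x : E3)‖ = 1 := by simp
  have hvv : 0 < ⟪v, v⟫ := by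
    rw [real_inner_self_eq_norm_sq]; exact pow_pos (norm_pos_iff.mpr hv) 2
  -- the curve `x - ε v`, normalised
  have hne : ∀ ε : ℝ, (x : E3) - ε • v ≠ 0 := by
    intro ε h0
    have : ⟪(x : E3), (x : E3) - ε • v⟫ = 1 := by
      rw [inner_sub_right, real_inner_smul_right, real_inner_comm v (x : E3), ← h,
        real_inner_self_eq_norm_sq, hnx]
      norm_num
    rw [h0, inner_zero_right] at this
    norm_num at this
  let c : ℝ → Metric.sphere (0 : E3) 1 := fun ε =>
    ⟨‖(x : E3) - ε • v‖⁻¹ • ((x : E3) - ε • v), by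
      rw [mem_sphere_zero_iff_norm, norm_smul, norm_inv, norm_norm]
      exact inv_mul_cancel₀ (norm_ne_zero_iff.mpr (hne ε))⟩
  have hc : Continuous c := by
    refine Continuous.subtype_mk ?_ _
    have hc1 : Continuous fun ε : ℝ => (x : E3) - ε • v := by fun_prop
    exact (hc1.norm.inv₀ fun ε => norm_ne_zero_iff.mpr (hne ε)).smul hc1
  have hc0 : c 0 = x := by
    apply Subtype.ext
    simp [c, hnx]
  have hopen : IsOpen (c ⁻¹' interior ((↑) ⁻¹' T : Set (Metric.sphere (0 : E3) 1))) :=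
    isOpen_interior.preimage hc
  have hmem : (0 : ℝ) ∈ c ⁻¹' interior ((↑) ⁻¹' T : Set (Metric.sphere (0 : E3) 1)) := by
    rw [Set.mem_preimage, hc0]; exact hx
  obtain ⟨δ, hδ, hball⟩ := Metric.isOpen_iff.mp hopen 0 hmem
  have hin : δ / 2 ∈ Metric.ball (0 : ℝ) δ := by
    rw [Metric.mem_ball, dist_zero_right, Real.norm_eq_abs, abs_of_pos (by linarith)]; linarith
  have h1 := hT _ (Set.mem_preimage.mp (interior_subset (hball hin)))
  simp only [c, real_inner_smul_right, inner_sub_right, ← h] at h1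
  have h2 : 0 < ‖(x : E3) - (δ / 2) • v‖⁻¹ := inv_pos.mpr (norm_pos_iff.mpr (hne _))
  have h3 : 0 < ‖(x : E3) - (δ / 2) • v‖⁻¹ * (δ / 2 * ⟪v, v⟫) :=
    mul_pos h2 (mul_pos (by linarith) hvv)
  linarith

lemma inner3 (a b c : ℝ) (x : E3) : ⟪!₂[a, b, c], x⟫ = a * x 0 + b * x 1 + c * x 2 := by
  simp [PiLp.inner_apply, Fin.sum_univ_three]; ring

lemma vec3_ne (a b c : ℝ) (ha : a ≠ 0 ∨ b ≠ 0) : (!₂[a, b, c] : E3) ≠ 0 := by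
  intro h
  rcases ha with ha | ha
  · exact ha (by simpa using congrArg (fun v : E3 => v 0) h)
  · exact ha (by simpa using congrArg (fun v : E3 => v 1) h)

lemma norm3 (a b c : ℝ) (h : a ^ 2 + b ^ 2 + c ^ 2 = 1) : ‖(!₂[a, b, c] : E3)‖ = 1 := by
  have : ‖(!₂[a, b, c] : E3)‖ ^ 2 = 1 := by
    rw [← real_inner_self_eq_norm_sq, inner3]
    simp
    linarith
  nlinarith [norm_nonneg (!₂[a, b, c] : E3)]

lemma inner33 (a b c a' b' c' : ℝ) :
    ⟪(!₂[a, b, c] : E3), !₂[a', b', c']⟫ = a * a' + b * b' + c * c' := by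
  rw [inner3]; simp

/-- Vertices of the tile. -/
noncomputable def vA (t s c w : ℝ) : E3 :=
  !₂[(1 + t ^ 2) / (2 * t ^ 2) * (c * w), (1 + t ^ 2) / (2 * t ^ 2) * (s * w),
    (1 + t ^ 2) / (2 * t ^ 2) * (s * c * (1 - t))]

noncomputable def vB (t s c w : ℝ) : E3 :=
  !₂[(1 + t ^ 2) / (2 * t) * (c * w), (1 + t ^ 2) / (2 * t) * (-(s * w)),
    (1 + t ^ 2) / (2 * t) * (s * c * (1 + t))]

noncomputable def vC (t s c w : ℝ) : E3 :=
  !₂[(1 + t ^ 2) / (2 * t) * (c * w), (1 + t ^ 2) / (2 * t) * (s * w),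
    (1 + t ^ 2) / (2 * t) * (-(s * c * (1 + t)))]

section
variable {t s c w : ℝ}

lemma vA_norm (ht : 0 < t) (hs : s ^ 2 = t * (1 + t) / (1 + t ^ 2))
    (hc : c ^ 2 = (1 - t) / (1 + t ^ 2)) (hw : w ^ 2 = t * (t ^ 2 + 2 * t - 1) / (1 + t ^ 2)) :
    ‖vA t s c w‖ = 1 := by
  apply norm3
  simp only [mul_pow, hs, hc, hw]
  field_simp
  ring

lemma vB_norm (ht : 0 < t) (hs : s ^ 2 = t * (1 + t) / (1 + t ^ 2))
    (hc : c ^ 2 = (1 - t) / (1 + t ^ 2)) (hw : w ^ 2 = t * (t ^ 2 + 2 * t - 1) / (1 + t ^ 2)) :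
    ‖vB t s c w‖ = 1 := by
  apply norm3
  simp only [mul_pow, neg_sq, hs, hc, hw]
  field_simp
  ring

lemma vC_norm (ht : 0 < t) (hs : s ^ 2 = t * (1 + t) / (1 + t ^ 2))
    (hc : c ^ 2 = (1 - t) / (1 + t ^ 2)) (hw : w ^ 2 = t * (t ^ 2 + 2 * t - 1) / (1 + t ^ 2)) :
    ‖vC t s c w‖ = 1 := by
  apply norm3
  simp only [mul_pow, neg_sq, hs, hc, hw]
  field_simp
  ring

lemma inner_AB (ht : 0 < t) (hs : s ^ 2 = t * (1 + t) / (1 + t ^ 2))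
    (hc : c ^ 2 = (1 - t) / (1 + t ^ 2)) (hw : w ^ 2 = t * (t ^ 2 + 2 * t - 1) / (1 + t ^ 2)) :
    ⟪vA t s c w, vB t s c w⟫ = (1 - t - t ^ 2) / t := by
  rw [vA, vB, inner33]
  trans (1 + t ^ 2) / (2 * t ^ 2) * ((1 + t ^ 2) / (2 * t)) *
    (c ^ 2 * w ^ 2 - s ^ 2 * w ^ 2 + s ^ 2 * c ^ 2 * (1 - t ^ 2))
  · ring
  · rw [hs, hc, hw]
    field_simp
    ring

lemma inner_AC (ht : 0 < t) (hs : s ^ 2 = t * (1 + t) / (1 + t ^ 2))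
    (hc : c ^ 2 = (1 - t) / (1 + t ^ 2)) (hw : w ^ 2 = t * (t ^ 2 + 2 * t - 1) / (1 + t ^ 2)) :
    ⟪vA t s c w, vC t s c w⟫ = (t ^ 3 + t ^ 2 + t - 1) / (2 * t ^ 2) := by
  rw [vA, vC, inner33]
  trans (1 + t ^ 2) / (2 * t ^ 2) * ((1 + t ^ 2) / (2 * t)) *
    (c ^ 2 * w ^ 2 + s ^ 2 * w ^ 2 - s ^ 2 * c ^ 2 * (1 - t ^ 2))
  · ring
  · rw [hs, hc, hw]
    field_simp
    ring

lemma inner_BC (ht : 0 < t) (hs : s ^ 2 = t * (1 + t) / (1 + t ^ 2))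
    (hc : c ^ 2 = (1 - t) / (1 + t ^ 2)) (hw : w ^ 2 = t * (t ^ 2 + 2 * t - 1) / (1 + t ^ 2)) :
    ⟪vB t s c w, vC t s c w⟫ = (-1 + t - t ^ 2 - t ^ 3) / (2 * t) := by
  rw [vB, vC, inner33]
  trans ((1 + t ^ 2) / (2 * t)) ^ 2 *
    (c ^ 2 * w ^ 2 - s ^ 2 * w ^ 2 - s ^ 2 * c ^ 2 * (1 + t) ^ 2)
  · ring
  · rw [hs, hc, hw]
    field_simp
    ring

lemma vec_lin_indep (ht : 0 < t) (hs : 0 < s) (hc : 0 < c) (hw : 0 < w) :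
    LinearIndependent ℝ ![vA t s c w, vB t s c w, vC t s c w] := by
  rw [Fintype.linearIndependent_iff]
  intro g hg
  rw [Fin.sum_univ_three] at hg
  have e0 := congrArg (fun v : E3 => v 0) hg
  have e1 := congrArg (fun v : E3 => v 1) hg
  have e2 := congrArg (fun v : E3 => v 2) hg
  simp [vA, vB, vC] at e0 e1 e2
  have hk : (1 + t ^ 2) / t * (s * c * w) ≠ 0 := by positivity
  have hk2 : (1 + t ^ 2) / t ^ 2 * (s * c * w) ≠ 0 := by positivity
  have h0 : g 0 * ((1 + t ^ 2) / t ^ 2 * (s * c * w)) = 0 := by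
    linear_combination ((1 + t) * c) * e1 + w * e2
  have h1 : g 1 * ((1 + t ^ 2) / t * (s * c * w)) = 0 := by
    linear_combination s * e0 - c * e1
  have h2 : g 2 * ((1 + t ^ 2) / t * (s * c * w)) = 0 := by
    linear_combination s * e0 - (t * c) * e1 - w * e2
  have g0 := (mul_eq_zero.mp h0).resolve_right hk2
  have g1 := (mul_eq_zero.mp h1).resolve_right hk
  have g2 := (mul_eq_zero.mp h2).resolve_right hk
  intro i
  fin_cases i
  · exact g0
  · exact g1
  · exact g2

lemma mem_tri (ht : 0 < t) (hs : 0 < s) (hc : 0 < c) (hw : 0 < w) (x : E3) :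
    x ∈ sphericalTriangle (vA t s c w) (vB t s c w) (vC t s c w) ↔
      ‖x‖ = 1 ∧ MTile t (s * x 0) (c * x 1) (w * x 2) := by
  unfold sphericalTriangle MTile
  rw [Set.mem_inter_iff, mem_sphere_zero_iff_norm, Set.mem_ofPred_eq]
  refine and_congr_right fun _ => ?_
  have hk : 0 < (1 + t ^ 2) / t * (s * c * w) := by positivity
  have hk2 : 0 < (1 + t ^ 2) / t ^ 2 * (s * c * w) := by positivity
  constructor
  · rintro ⟨α, β, δ, hα, hβ, hδ, rfl⟩
    simp [vA, vB, vC]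
    refine ⟨?_, ?_, ?_⟩
    · refine (mul_nonneg hα hk2.le).trans (le_of_eq ?_)
      ring
    · rw [← sub_nonneg]
      refine (mul_nonneg hβ hk.le).trans (le_of_eq ?_)
      ring
    · rw [← sub_nonneg]
      refine (mul_nonneg hδ hk.le).trans (le_of_eq ?_)
      ring
  · rintro ⟨h1, h2, h3⟩
    refine ⟨_, _, _, div_nonneg h1 hk2.le, div_nonneg h2 hk.le, div_nonneg h3 hk.le, ?_⟩
    ext i
    fin_cases i
    · simp [vA, vB, vC]
      field_simp
      ring
    · simp [vA, vB, vC]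
      field_simp
      ring
    · simp [vA, vB, vC]
      field_simp
      ring

/-- Normal of the mirror plane. -/
noncomputable def vN (t s c w : ℝ) : E3 := !₂[s, -(t * c), -w]

lemma vN_inner (ht : 0 < t) (hs : s ^ 2 = t * (1 + t) / (1 + t ^ 2))
    (hc : c ^ 2 = (1 - t) / (1 + t ^ 2)) (hw : w ^ 2 = t * (t ^ 2 + 2 * t - 1) / (1 + t ^ 2)) :
    (1 + t ^ 2) / (2 * t ^ 2) * ⟪vN t s c w, vN t s c w⟫ = 2 := by
  rw [vN, inner33]
  trans (1 + t ^ 2) / (2 * t ^ 2) * (s ^ 2 + t ^ 2 * c ^ 2 + w ^ 2)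
  · ring
  · rw [hs, hc, hw]
    field_simp
    ring

lemma refl_tile (ht : 0 < t) (hs : s ^ 2 = t * (1 + t) / (1 + t ^ 2))
    (hc : c ^ 2 = (1 - t) / (1 + t ^ 2)) (hw : w ^ 2 = t * (t ^ 2 + 2 * t - 1) / (1 + t ^ 2))
    (x y : E3) (hy : y = reflMap ((1 + t ^ 2) / (2 * t ^ 2)) (vN t s c w) x) :
    MTile t (s * y 0) (c * y 1) (w * y 2) ↔ RTile t (s * x 0) (c * x 1) (w * x 2) := by
  rw [reflMap_apply, vN, inner3] at hy
  set N := s * x 0 + -(t * c) * x 1 + -w * x 2 with hN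
  have y0 : y 0 = x 0 - (1 + t ^ 2) / (2 * t ^ 2) * N * s := by rw [hy]; simp
  have y1 : y 1 = x 1 + (1 + t ^ 2) / (2 * t ^ 2) * N * (t * c) := by rw [hy]; simp
  have y2 : y 2 = x 2 + (1 + t ^ 2) / (2 * t ^ 2) * N * w := by rw [hy]; simp
  have X : s * y 0 = s * x 0 - (1 + t) / (2 * t) * N := by
    trans s * x 0 - (1 + t ^ 2) / (2 * t ^ 2) * N * s ^ 2
    · rw [y0]; ring
    · rw [hs]; field_simp
  have Y : c * y 1 = c * x 1 + (1 - t) / (2 * t) * N := by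
    trans c * x 1 + (1 + t ^ 2) / (2 * t ^ 2) * N * t * c ^ 2
    · rw [y1]; ring
    · rw [hc]; field_simp
  have Z : w * y 2 = w * x 2 + (t ^ 2 + 2 * t - 1) / (2 * t) * N := by
    trans w * x 2 + (1 + t ^ 2) / (2 * t ^ 2) * N * w ^ 2
    · rw [y2]; ring
    · rw [hw]; field_simp
  have f1 : (1 + t) * (c * y 1) + w * y 2 = s * x 0 + c * x 1 := by
    rw [Y, Z]; field_simp; rw [hN]; ring
  have f2 : t * (s * y 0 - c * y 1) = w * x 2 - (1 - t) * (s * x 0) := by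
    rw [X, Y]; field_simp; rw [hN]; ring
  have f3 : s * y 0 - t * (c * y 1) - w * y 2 = t * (c * x 1) + w * x 2 - s * x 0 := by
    rw [X, Y, Z]; field_simp; rw [hN]; ring
  unfold MTile RTile
  rw [f1, f3, ← f2, mul_nonneg_iff_of_pos_left ht]

end

/-- The tiling, once the scalars are given. -/
lemma tiling_of (t s c w : ℝ) (ht : 0 < t) (ht1 : t < 1) (hs0 : 0 < s) (hc0 : 0 < c) (hw0 : 0 < w)
    (hs : s ^ 2 = t * (1 + t) / (1 + t ^ 2)) (hc : c ^ 2 = (1 - t) / (1 + t ^ 2))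
    (hw : w ^ 2 = t * (t ^ 2 + 2 * t - 1) / (1 + t ^ 2)) :
    ∃ T : Fin 8 → Set (EuclideanSpace ℝ (Fin 3)),
        (∀ i, ∃ g : EuclideanSpace ℝ (Fin 3) ≃ₗᵢ[ℝ] EuclideanSpace ℝ (Fin 3),
          T i = g '' sphericalTriangle (vA t s c w) (vB t s c w) (vC t s c w)) ∧
        (⋃ i, T i) = Metric.sphere (0 : EuclideanSpace ℝ (Fin 3)) 1 ∧
        Pairwise fun i j => Disjoint
          (interior ((↑) ⁻¹' T i : Set (Metric.sphere (0 : EuclideanSpace ℝ (Fin 3)) 1)))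
          (interior ((↑) ⁻¹' T j : Set (Metric.sphere (0 : EuclideanSpace ℝ (Fin 3)) 1))) := by
  have hκ := vN_inner ht hs hc hw
  set Δ := sphericalTriangle (vA t s c w) (vB t s c w) (vC t s c w) with hΔ
  let D : Fin 4 → E3 ≃ₗᵢ[ℝ] E3 := fun j => involIso (diagMap j) (diagMap_invol j) (diagMap_norm j)
  let R : E3 ≃ₗᵢ[ℝ] E3 := involIso _ (reflMap_invol _ _ hκ) (reflMap_norm _ _ hκ)
  let T : Fin 4 × Bool → Set E3 := fun p => if p.2 then D p.1 '' (R '' Δ) else D p.1 '' Δ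
  have memM : ∀ (j : Fin 4) (x : E3), x ∈ T (j, false) ↔ ‖x‖ = 1 ∧
      MTile t (sg j 0 * (s * x 0)) (sg j 1 * (c * x 1)) (sg j 2 * (w * x 2)) := by
    intro j x
    have : x ∈ T (j, false) ↔ diagMap j x ∈ Δ := mem_involIso_image _ _ _ _ _
    rw [this, mem_tri ht hs0 hc0 hw0, diagMap_norm]
    simp only [diagMap_apply, mul_left_comm]
  have memR : ∀ (j : Fin 4) (x : E3), x ∈ T (j, true) ↔ ‖x‖ = 1 ∧
      RTile t (sg j 0 * (s * x 0)) (sg j 1 * (c * x 1)) (sg j 2 * (w * x 2)) := by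
    intro j x
    have h1 : x ∈ T (j, true) ↔ diagMap j x ∈ R '' Δ := mem_involIso_image _ _ _ _ _
    rw [h1, mem_involIso_image, mem_tri ht hs0 hc0 hw0, reflMap_norm _ _ hκ, diagMap_norm,
      refl_tile ht hs hc hw (diagMap j x) _ rfl]
    simp only [diagMap_apply, mul_left_comm]
  have sgne : ∀ j i, sg j i ≠ 0 := by
    intro j i h
    have := sg_sq j i
    rw [h] at this
    norm_num at this
  have intM : ∀ (j : Fin 4) (x : Metric.sphere (0 : E3) 1),
      x ∈ interior ((↑) ⁻¹' T (j, false) : Set (Metric.sphere (0 : E3) 1)) →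
      ODart t (sg j 0 * (s * x.1 0)) (sg j 1 * (c * x.1 1)) (sg j 2 * (w * x.1 2)) ∧
      0 < sg j 0 * (s * x.1 0) - t * (sg j 1 * (c * x.1 1)) - sg j 2 * (w * x.1 2) := by
    intro j x hx
    have a1 := strict_of_interior !₂[0, (1 + t) * (sg j 1 * c), sg j 2 * w]
      (vec3_ne _ _ _ (Or.inr (mul_ne_zero (by linarith) (mul_ne_zero (sgne _ _) hc0.ne')))) _
      (fun y hy => by rw [inner3]; have := ((memM j y).1 hy).2.1; linarith) x hx
    have a2 := strict_of_interior !₂[sg j 0 * s, - (sg j 1 * c), 0]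
      (vec3_ne _ _ _ (Or.inl (mul_ne_zero (sgne _ _) hs0.ne'))) _
      (fun y hy => by rw [inner3]; have := ((memM j y).1 hy).2.2.1; linarith) x hx
    have a3 := strict_of_interior !₂[sg j 0 * s, - (t * (sg j 1 * c)), -(sg j 2 * w)]
      (vec3_ne _ _ _ (Or.inl (mul_ne_zero (sgne _ _) hs0.ne'))) _
      (fun y hy => by rw [inner3]; have := ((memM j y).1 hy).2.2.2; linarith) x hx
    rw [inner3] at a1 a2 a3
    exact ⟨⟨by linarith, by linarith, Or.inl (by linarith)⟩, by linarith⟩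
  have intR : ∀ (j : Fin 4) (x : Metric.sphere (0 : E3) 1),
      x ∈ interior ((↑) ⁻¹' T (j, true) : Set (Metric.sphere (0 : E3) 1)) →
      ODart t (sg j 0 * (s * x.1 0)) (sg j 1 * (c * x.1 1)) (sg j 2 * (w * x.1 2)) ∧
      sg j 0 * (s * x.1 0) - t * (sg j 1 * (c * x.1 1)) - sg j 2 * (w * x.1 2) < 0 := by
    intro j x hx
    have a1 := strict_of_interior !₂[sg j 0 * s, sg j 1 * c, 0]
      (vec3_ne _ _ _ (Or.inl (mul_ne_zero (sgne _ _) hs0.ne'))) _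
      (fun y hy => by rw [inner3]; have := ((memR j y).1 hy).2.1; linarith) x hx
    have a2 := strict_of_interior !₂[-((1 - t) * (sg j 0 * s)), 0, sg j 2 * w]
      (vec3_ne _ _ _ (Or.inl (neg_ne_zero.mpr (mul_ne_zero (by linarith)
        (mul_ne_zero (sgne _ _) hs0.ne'))))) _
      (fun y hy => by rw [inner3]; have := ((memR j y).1 hy).2.2.1; linarith) x hx
    have a3 := strict_of_interior !₂[-(sg j 0 * s), t * (sg j 1 * c), sg j 2 * w]
      (vec3_ne _ _ _ (Or.inl (neg_ne_zero.mpr (mul_ne_zero (sgne _ _) hs0.ne')))) _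
      (fun y hy => by rw [inner3]; have := ((memR j y).1 hy).2.2.2; linarith) x hx
    rw [inner3] at a1 a2 a3
    exact ⟨⟨by linarith, by linarith, Or.inr (by linarith)⟩, by linarith⟩
  let e : Fin 8 ≃ Fin 4 × Bool := (Fintype.equivFinOfCardEq (by simp)).symm
  refine ⟨fun i => T (e i), ?_, ?_, ?_⟩
  · intro i
    dsimp only
    generalize e i = p
    obtain ⟨j, b⟩ := p
    cases b
    · exact ⟨D j, rfl⟩
    · refine ⟨R.trans (D j), ?_⟩
      change D j '' (R '' Δ) = _
      rw [Set.image_image]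
      rfl
  · ext x
    rw [Set.mem_iUnion, mem_sphere_zero_iff_norm]
    constructor
    · rintro ⟨i, hi⟩
      revert hi
      generalize e i = p
      intro hi
      obtain ⟨j, b⟩ := p
      cases b
      · exact ((memM j x).1 hi).1
      · exact ((memR j x).1 hi).1
    · intro hx
      have key : ∃ p, x ∈ T p := by
        have hc := cover t (s * x 0) (c * x 1) (w * x 2) ht
        rcases hc with (h | h) | (h | h) | (h | h) | (h | h)
        · exact ⟨(0, false), (memM _ _).2 ⟨hx, by simpa [sg] using h⟩⟩
        · exact ⟨(0, true), (memR _ _).2 ⟨hx, by simpa [sg] using h⟩⟩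
        · exact ⟨(1, false), (memM _ _).2 ⟨hx, by simpa [sg] using h⟩⟩
        · exact ⟨(1, true), (memR _ _).2 ⟨hx, by simpa [sg] using h⟩⟩
        · exact ⟨(2, false), (memM _ _).2 ⟨hx, by simpa [sg] using h⟩⟩
        · exact ⟨(2, true), (memR _ _).2 ⟨hx, by simpa [sg] using h⟩⟩
        · exact ⟨(3, false), (memM _ _).2 ⟨hx, by simpa [sg] using h⟩⟩
        · exact ⟨(3, true), (memR _ _).2 ⟨hx, by simpa [sg] using h⟩⟩
      obtain ⟨p, hp⟩ := key
      exact ⟨e.symm p, by simpa using hp⟩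
  · intro i i' hne
    rw [Set.disjoint_left]
    intro x hx hx'
    have hne' : e i ≠ e i' := fun h => hne (e.injective h)
    revert hx hx' hne'
    dsimp only
    generalize e i = p
    generalize e i' = p'
    obtain ⟨j, b⟩ := p
    obtain ⟨j', b'⟩ := p'
    intro hx hx' hne'
    cases b <;> cases b'
    · have h1 := intM _ _ hx
      have h2 := intM _ _ hx'
      exact hne' (by rw [odart_disj h1.1 h2.1])
    · have h1 := intM _ _ hx
      have h2 := intR _ _ hx'
      have := odart_disj h1.1 h2.1
      subst this
      linarith [h1.2, h2.2]
    · have h1 := intR _ _ hx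
      have h2 := intM _ _ hx'
      have := odart_disj h1.1 h2.1
      subst this
      linarith [h1.2, h2.2]
    · have h1 := intR _ _ hx
      have h2 := intR _ _ hx'
      exact hne' (by rw [odart_disj h1.1 h2.1])

/-- Existence of the tiling `T(4α²γ; 4β²γ)` with 8 tiles, for the one-parameter family
of triangles with angles `(π − γ/2, π/2 − γ/2, γ)`, `γ ∈ (π/4, π/2)`. -/
theorem eight_tile_tiling (γ : ℝ)
    (h₁ : Real.pi / 4 < γ) (h₂ : γ < Real.pi / 2) :
    ∃ A B C : EuclideanSpace ℝ (Fin 3),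
      LinearIndependent ℝ ![A, B, C] ∧ ‖A‖ = 1 ∧ ‖B‖ = 1 ∧ ‖C‖ = 1 ∧
      cornerAngle A B C = Real.pi - γ / 2 ∧
      cornerAngle B A C = Real.pi / 2 - γ / 2 ∧
      cornerAngle C A B = γ ∧
      ∃ T : Fin 8 → Set (EuclideanSpace ℝ (Fin 3)),
        (∀ i, ∃ g : EuclideanSpace ℝ (Fin 3) ≃ₗᵢ[ℝ] EuclideanSpace ℝ (Fin 3),
          T i = g '' sphericalTriangle A B C) ∧
        (⋃ i, T i) = Metric.sphere (0 : EuclideanSpace ℝ (Fin 3)) 1 ∧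
        Pairwise fun i j => Disjoint
          (interior ((↑) ⁻¹' T i : Set (Metric.sphere (0 : EuclideanSpace ℝ (Fin 3)) 1)))
          (interior ((↑) ⁻¹' T j : Set (Metric.sphere (0 : EuclideanSpace ℝ (Fin 3)) 1))) := by
  have hpi := Real.pi_pos
  have hC : 0 < Real.cos (γ / 2) := Real.cos_pos_of_mem_Ioo ⟨by linarith, by linarith⟩
  have hS : 0 < Real.sin (γ / 2) := Real.sin_pos_of_pos_of_lt_pi (by linarith) (by linarith)
  have hSC := Real.sin_sq_add_cos_sq (γ / 2)
  have hcosγ : Real.cos γ = Real.cos (γ / 2) ^ 2 - Real.sin (γ / 2) ^ 2 := by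
    rw [← Real.cos_two_mul']; congr 1; ring
  have hsinγ : Real.sin γ = 2 * Real.sin (γ / 2) * Real.cos (γ / 2) := by
    rw [← Real.sin_two_mul]; congr 1; ring
  have hγ0 : 0 < Real.cos γ := Real.cos_pos_of_mem_Ioo ⟨by linarith, by linarith⟩
  have hγ1 : Real.cos γ < Real.sin γ := by
    rw [← Real.sin_pi_div_two_sub]
    exact Real.sin_lt_sin_of_lt_of_le_pi_div_two (by linarith) (by linarith) (by linarith)
  obtain ⟨t, htdef⟩ : ∃ t, t = Real.sin (γ / 2) / Real.cos (γ / 2) := ⟨_, rfl⟩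
  have hSt : Real.sin (γ / 2) = t * Real.cos (γ / 2) := by rw [htdef]; field_simp
  have hC2 : Real.cos (γ / 2) ^ 2 = 1 / (1 + t ^ 2) := by
    rw [hSt] at hSC
    field_simp
    linarith
  have hS2 : Real.sin (γ / 2) ^ 2 = t ^ 2 / (1 + t ^ 2) := by
    rw [hSt, mul_pow, hC2]; ring
  have ht : 0 < t := by rw [htdef]; positivity
  have hcg : Real.cos γ = (1 - t ^ 2) / (1 + t ^ 2) := by rw [hcosγ, hC2, hS2]; ring
  have hsg : Real.sin γ = 2 * t / (1 + t ^ 2) := by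
    rw [hsinγ, hSt]
    trans 2 * t * Real.cos (γ / 2) ^ 2
    · ring
    · rw [hC2]; ring
  have hpos : (0 : ℝ) < 1 + t ^ 2 := by positivity
  have ht1 : t < 1 := by
    rw [hcg] at hγ0
    have := (div_pos_iff_of_pos_right hpos).mp hγ0
    nlinarith
  have ht2 : 0 < t ^ 2 + 2 * t - 1 := by
    rw [hcg, hsg] at hγ1
    have := (div_lt_div_iff_of_pos_right hpos).mp hγ1
    linarith
  have h1t : 0 < 1 - t := by linarith
  have hs' : 0 < t * (1 + t) / (1 + t ^ 2) := by positivity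
  have hc' : 0 < (1 - t) / (1 + t ^ 2) := by positivity
  have hw' : 0 < t * (t ^ 2 + 2 * t - 1) / (1 + t ^ 2) := by positivity
  obtain ⟨s, hs0, hs⟩ : ∃ s : ℝ, 0 < s ∧ s ^ 2 = t * (1 + t) / (1 + t ^ 2) :=
    ⟨_, Real.sqrt_pos.mpr hs', Real.sq_sqrt hs'.le⟩
  obtain ⟨c, hc0, hc⟩ : ∃ c : ℝ, 0 < c ∧ c ^ 2 = (1 - t) / (1 + t ^ 2) :=
    ⟨_, Real.sqrt_pos.mpr hc', Real.sq_sqrt hc'.le⟩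
  obtain ⟨w, hw0, hw⟩ : ∃ w : ℝ, 0 < w ∧ w ^ 2 = t * (t ^ 2 + 2 * t - 1) / (1 + t ^ 2) :=
    ⟨_, Real.sqrt_pos.mpr hw', Real.sq_sqrt hw'.le⟩
  have nA := vA_norm ht hs hc hw
  have nB := vB_norm ht hs hc hw
  have nC := vC_norm ht hs hc hw
  have iAB := inner_AB ht hs hc hw
  have iAC := inner_AC ht hs hc hw
  have iBC := inner_BC ht hs hc hw
  have iBA := (real_inner_comm (vB t s c w) (vA t s c w)).symm.trans iAB
  have iCA := (real_inner_comm (vC t s c w) (vA t s c w)).symm.trans iAC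
  have iCB := (real_inner_comm (vC t s c w) (vB t s c w)).symm.trans iBC
  have qAB : 0 < 1 - ((1 - t - t ^ 2) / t) ^ 2 := by
    have : 1 - ((1 - t - t ^ 2) / t) ^ 2 = (1 - t) * (1 + t) * (t ^ 2 + 2 * t - 1) / t ^ 2 := by
      field_simp; ring
    rw [this]; positivity
  have qAC : 0 < 1 - ((t ^ 3 + t ^ 2 + t - 1) / (2 * t ^ 2)) ^ 2 := by
    have : 1 - ((t ^ 3 + t ^ 2 + t - 1) / (2 * t ^ 2)) ^ 2 =
        (1 - t) * (1 + t) * (1 + t ^ 2) * (t ^ 2 + 2 * t - 1) / (4 * t ^ 4) := by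
      field_simp; ring
    rw [this]; positivity
  have qBC : 0 < 1 - ((-1 + t - t ^ 2 - t ^ 3) / (2 * t)) ^ 2 := by
    have : 1 - ((-1 + t - t ^ 2 - t ^ 3) / (2 * t)) ^ 2 =
        (1 - t) * (1 + t) * (1 + t ^ 2) * (t ^ 2 + 2 * t - 1) / (4 * t ^ 2) := by
      field_simp; ring
    rw [this]; positivity
  refine ⟨vA t s c w, vB t s c w, vC t s c w, vec_lin_indep ht hs0 hc0 hw0, nA, nB, nC, ?_, ?_, ?_,
    tiling_of t s c w ht ht1 hs0 hc0 hw0 hs hc hw⟩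
  · refine cornerAngle_eq_of _ _ _ _ _ _ _ nA nB nC iBA iCA iBC qAB qAC (by linarith) (by linarith)
      ?_ ?_
    · rw [Real.cos_pi_sub, neg_sq, hC2]; field_simp; ring
    · rw [Real.cos_pi_sub]
      have : (-1 + t - t ^ 2 - t ^ 3) / (2 * t) -
          (1 - t - t ^ 2) / t * ((t ^ 3 + t ^ 2 + t - 1) / (2 * t ^ 2)) =
          -((1 - t) * (1 + t) * (t ^ 2 + 2 * t - 1) / (2 * t ^ 3)) := by
        field_simp; ring
      rw [this, neg_mul_neg]; positivity
  · refine cornerAngle_eq_of _ _ _ _ _ _ _ nB nA nC iAB iCB iAC qAB qBC (by linarith) (by linarith)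
      ?_ ?_
    · rw [Real.cos_pi_div_two_sub, hS2]; field_simp; ring
    · rw [Real.cos_pi_div_two_sub]
      have : (t ^ 3 + t ^ 2 + t - 1) / (2 * t ^ 2) -
          (1 - t - t ^ 2) / t * ((-1 + t - t ^ 2 - t ^ 3) / (2 * t)) =
          (1 - t) * (1 + t) * (t ^ 2 + 2 * t - 1) / (2 * t) := by
        field_simp; ring
      rw [this]; positivity
  · refine cornerAngle_eq_of _ _ _ _ _ _ _ nC nA nB iAC iBC iAB qAC qBC (by linarith) (by linarith)
      ?_ ?_
    · rw [hcg]; field_simp; ring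
    · have : (1 - t - t ^ 2) / t - (t ^ 3 + t ^ 2 + t - 1) / (2 * t ^ 2) *
          ((-1 + t - t ^ 2 - t ^ 3) / (2 * t)) =
          (1 - t) ^ 2 * (1 + t) ^ 2 * (t ^ 2 + 2 * t - 1) / (4 * t ^ 3) := by
        field_simp; ring
      rw [this]; positivity
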